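/- (Dirac's Gluing Lemma, part (ii).) Let R be a commutative ring and let Δ and Γ be finite abstract simplicial complexes. If Δ is resolution k-chordal over R and the relative simplicial complex (Γ, Γ ∩ Δ) is resolution k-chordal over R, then Δ ∪ Γ is resolution k-chordal over R. -/

import Mathlib

/-!
Basic notions for homological chordality of simplicial complexes,
following Adiprasito–Nevo–Samper, "Higher chordality: From graphs to complexes".

A finite abstract simplicial complex is modelled as a downward-closed finite
family of finite subsets of a vertex type `V`.  Chains of dimension `k` (with
coefficients in a commutative ring `R`) are functions `Finset V → R` supported
on faces of cardinality `k + 1`; the simplicial boundary operator includes the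
augmentation (so `0`-cycles are *reduced* cycles), matching the paper's
convention that `C₋₁` is generated by the empty face.
-/

open Finset

attribute [local instance] Classical.propDecidable

noncomputable section

/-- A finite abstract simplicial complex with vertices in `V`:
a downward-closed finite family of finite subsets of `V`. -/
structure ASC (V : Type*) where
  faces : Finset (Finset V)
  down_closed : ∀ ⦃s t : Finset V⦄, s ∈ faces → t ⊆ s → t ∈ faces

variable {V : Type*} [Fintype V] [LinearOrder V]

/-- `(-1)` to the number of elements of `t` smaller than `v`; this is the sign
of the position of `v` in the ordered set `insert v t`. -/
def esign (v : V) (t : Finset V) : ℤ :=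
  (-1) ^ (t.filter fun w => w < v).card

/-- The simplicial boundary operator (including the augmentation at the empty
face): `(bdry c) t = ∑_{v ∉ t} ± c (insert v t)`. -/
def bdry {R : Type*} [CommRing R] (c : Finset V → R) : Finset V → R :=
  fun t => ∑ v ∈ tᶜ, esign v t • c (insert v t)

/-- `c` is a chain of dimension `k` on the set of faces `S`:
it is supported on members of `S` of cardinality `k + 1`. -/
def IsChainOn {R : Type*} [CommRing R] (S : Set (Finset V)) (k : ℤ)
    (c : Finset V → R) : Prop :=
  ∀ s : Finset V, c s ≠ 0 → s ∈ S ∧ (s.card : ℤ) = k + 1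

/-- The vertex support `c⁰` of a chain: all vertices lying in a face with a
nonzero coefficient. -/
def vsupp {R : Type*} [CommRing R] (c : Finset V → R) : Set V :=
  {v | ∃ s : Finset V, c s ≠ 0 ∧ v ∈ s}

/-- Vanishing of the `k`-th (reduced) homology of the family of faces `S` over `R`:
every `k`-cycle is the boundary of a `(k+1)`-chain. -/
def HVanish (R : Type*) [CommRing R] (S : Set (Finset V)) (k : ℤ) : Prop :=
  ∀ z : Finset V → R, IsChainOn S k z → bdry z = 0 →
    ∃ c : Finset V → R, IsChainOn S (k + 1) c ∧ bdry c = z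

/-- `Δ` is resolution `k`-chordal over `R`: every `k`-cycle `z` of `Δ` admits a
resolution, i.e. a `(k+1)`-chain `c` of `Δ` with `∂c = z` and the same vertex
support as `z`. -/
def ResChordal (R : Type*) [CommRing R] (Δ : ASC V) (k : ℤ) : Prop :=
  ∀ z : Finset V → R, IsChainOn (↑Δ.faces) k z → bdry z = 0 →
    ∃ c : Finset V → R, IsChainOn (↑Δ.faces) (k + 1) c ∧ bdry c = z ∧ vsupp c = vsupp z

/-- `z` is a complete `k`-cycle on the face set `S`: it is a `k`-cycle whose
faces with nonzero coefficient are precisely all the `k`-dimensional faces of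
some set `W` of `k + 2` vertices, and all those faces belong to `S`. -/
def IsCompleteCycleOn {R : Type*} [CommRing R] (S : Set (Finset V)) (k : ℤ)
    (z : Finset V → R) : Prop :=
  bdry z = 0 ∧ ∃ W : Finset V, (W.card : ℤ) = k + 2 ∧
    (∀ s : Finset V, z s ≠ 0 ↔ s ⊆ W ∧ (s.card : ℤ) = k + 1) ∧
    ∀ s : Finset V, s ⊆ W → (s.card : ℤ) = k + 1 → s ∈ S

/-- `Δ` is decomposition `k`-chordal over `R`: every `k`-cycle `z` of `Δ` is a
sum of complete `k`-cycles of `Δ` supporting only vertices supported in `z`. -/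
def DecChordal (R : Type*) [CommRing R] (Δ : ASC V) (k : ℤ) : Prop :=
  ∀ z : Finset V → R, IsChainOn (↑Δ.faces) k z → bdry z = 0 →
    ∃ (n : ℕ) (zs : Fin n → Finset V → R),
      z = ∑ i, zs i ∧
      ∀ i, IsCompleteCycleOn (↑Δ.faces) k (zs i) ∧ vsupp (zs i) ⊆ vsupp z

/-- `σ` is a missing face (minimal nonface) of `Δ`: `σ` is not a face but all
its proper subsets are.  Its dimension is `σ.card - 1`. -/
def IsMissingFace (Δ : ASC V) (σ : Finset V) : Prop :=
  σ ∉ Δ.faces ∧ ∀ t ⊂ σ, t ∈ Δ.faces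

/-- The induced subcomplex `Δ|W` on a subset `W` of the vertices. -/
def induced (Δ : ASC V) (W : Finset V) : ASC V where
  faces := Δ.faces.filter fun s => s ⊆ W
  down_closed := by
    intro s t hs hts
    simp only [mem_filter] at hs ⊢
    exact ⟨Δ.down_closed hs.1 hts, hts.trans hs.2⟩

/-- `Δ` is `k`-Leray over `R`: the reduced homology `H̃ⱼ(Δ|W; R)` vanishes for
every `j ≥ k` and every vertex subset `W`. -/
def IsLeray (R : Type*) [CommRing R] (Δ : ASC V) (k : ℤ) : Prop :=
  ∀ (W : Finset V) (j : ℤ), k ≤ j → HVanish R (((induced Δ W).faces : Set (Finset V))) j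

/-- The closed star `St_σ Δ = ∪_{σ ⊆ τ ∈ Δ} 2^τ`. -/
def star (Δ : ASC V) (σ : Finset V) : ASC V where
  faces := Δ.faces.filter fun s => ∃ τ ∈ Δ.faces, σ ⊆ τ ∧ s ⊆ τ
  down_closed := by
    intro s t hs hts
    simp only [mem_filter] at hs ⊢
    obtain ⟨h1, τ', h2, h3, h4⟩ := hs
    exact ⟨Δ.down_closed h1 hts, τ', h2, h3, hts.trans h4⟩

/-- The deletion `Δ - σ`: the maximal subcomplex of `Δ` not containing `σ`. -/
def del (Δ : ASC V) (σ : Finset V) : ASC V where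
  faces := Δ.faces.filter fun s => ¬ σ ⊆ s
  down_closed := by
    intro s t hs hts
    simp only [mem_filter] at hs ⊢
    exact ⟨Δ.down_closed hs.1 hts, fun h => hs.2 (h.trans hts)⟩

/-- The extended link `eLk_σ Δ = St_σ Δ - σ`. -/
def eLk (Δ : ASC V) (σ : Finset V) : ASC V := del (star Δ σ) σ

/-- The link `Lk_σ Δ = {τ \ σ : σ ⊆ τ ∈ Δ}`. -/
def link (Δ : ASC V) (σ : Finset V) : ASC V where
  faces := Finset.univ.filter fun t => Disjoint σ t ∧ σ ∪ t ∈ Δ.faces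
  down_closed := by
    intro s t hs hts
    simp only [mem_filter, mem_univ, true_and] at hs ⊢
    exact ⟨hs.1.mono_right hts, Δ.down_closed hs.2 (union_subset_union_right hts)⟩

/-- The `k`-clique complex `Cl_k Δ`: faces are the sets of vertices of `Δ` all
of whose subsets of cardinality at most `k + 1` are faces of `Δ`. -/
def clique (Δ : ASC V) (k : ℤ) : ASC V where
  faces := Finset.univ.filter fun s =>
    (∀ v ∈ s, {v} ∈ Δ.faces) ∧ ∀ t ⊆ s, (t.card : ℤ) ≤ k + 1 → t ∈ Δ.faces
  down_closed := by
    intro s t hs hts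
    simp only [mem_filter, mem_univ, true_and] at hs ⊢
    exact ⟨fun v hv => hs.1 v (hts hv), fun u hu hc => hs.2 u (hu.trans hts) hc⟩

/-- The vertex set of a complex, as a set of elements of `V`. -/
def vertexSet (Δ : ASC V) : Set V := {v | {v} ∈ Δ.faces}

/-- The relative simplicial complex `(Δ, Γ)` is resolution `k`-chordal over `R`:
every relative `k`-cycle (a `k`-chain of `Δ` supported off `Γ` whose boundary
is a chain of `Γ`) admits a resolution, i.e. a `(k+1)`-chain `c` of `Δ`
supported off `Γ` with `∂c ≡ z` modulo chains of `Γ` and `vsupp c = vsupp z`. -/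
def RelResChordal (R : Type*) [CommRing R] (Δ Γ : ASC V) (k : ℤ) : Prop :=
  ∀ z : Finset V → R, IsChainOn (↑Δ.faces) k z → (∀ s, z s ≠ 0 → s ∉ Γ.faces) →
    IsChainOn (↑Γ.faces) (k - 1) (bdry z) →
    ∃ c : Finset V → R, IsChainOn (↑Δ.faces) (k + 1) c ∧ (∀ s, c s ≠ 0 → s ∉ Γ.faces) ∧
      IsChainOn (↑Γ.faces) k (bdry c - z) ∧ vsupp c = vsupp z

/-- The union of two simplicial complexes (taken facewise). -/
def aunion (Δ Γ : ASC V) : ASC V where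
  faces := Δ.faces ∪ Γ.faces
  down_closed := by
    intro s t hs hts
    rcases Finset.mem_union.1 hs with h | h
    · exact Finset.mem_union.2 (Or.inl (Δ.down_closed h hts))
    · exact Finset.mem_union.2 (Or.inr (Γ.down_closed h hts))

/-- The intersection of two simplicial complexes (taken facewise). -/
def ainter (Δ Γ : ASC V) : ASC V where
  faces := Δ.faces ∩ Γ.faces
  down_closed := by
    intro s t hs hts
    rw [Finset.mem_inter] at hs ⊢
    exact ⟨Δ.down_closed hs.1 hts, Γ.down_closed hs.2 hts⟩

/-- The `k`-skeleton of `Δ`: all faces of dimension at most `k`. -/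
def skel (Δ : ASC V) (k : ℤ) : ASC V where
  faces := Δ.faces.filter fun s => (s.card : ℤ) ≤ k + 1
  down_closed := by
    intro s t hs hts
    simp only [mem_filter] at hs ⊢
    refine ⟨Δ.down_closed hs.1 hts, le_trans ?_ hs.2⟩
    exact_mod_cast Finset.card_le_card hts

theorem esign_insert_mul_antisymm {v w : V} {t : Finset V} (hv : v ∉ t) (hw : w ∉ t)
    (hvw : v ≠ w) :
    esign v t * esign w (insert v t) = -(esign w t * esign v (insert w t)) := by
  have key : ∀ a b : V, a ∉ t → esign b (insert a t) = (if a < b then -1 else 1) * esign b t := by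
    intro a b ha
    unfold esign
    rw [Finset.filter_insert]
    split_ifs with h
    · rw [Finset.card_insert_of_notMem (fun h' => ha (Finset.mem_filter.1 h').1), pow_succ]
      ring
    · ring
  rw [key v w hv, key w v hw]
  rcases lt_or_gt_of_ne hvw with h | h
  · simp only [h, h.not_gt, if_true, if_false]
    ring
  · simp only [h, h.not_gt, if_true, if_false]
    ring

theorem bdry_bdry {R : Type*} [CommRing R] (c : Finset V → R) : bdry (bdry c) = 0 := by
  funext t
  simp only [bdry, Finset.smul_sum, Pi.zero_apply]
  rw [Finset.sum_sigma']
  refine Finset.sum_involution (fun p _ => ⟨p.2, p.1⟩) ?_ ?_ ?_ ?_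
  · rintro ⟨v, w⟩ h
    simp only [Finset.mem_sigma, Finset.mem_compl, Finset.mem_insert, not_or] at h
    rw [smul_smul, smul_smul, Finset.insert_comm w v t,
      esign_insert_mul_antisymm h.1 h.2.2 (Ne.symm h.2.1), neg_smul, neg_add_cancel]
  · rintro ⟨v, w⟩ h _ heq
    simp only [Finset.mem_sigma, Finset.mem_compl, Finset.mem_insert, not_or] at h
    simp only [Sigma.mk.injEq, heq_eq_eq] at heq
    exact h.2.1 heq.1
  · rintro ⟨v, w⟩ h
    simp only [Finset.mem_sigma, Finset.mem_compl, Finset.mem_insert, not_or] at h ⊢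
    exact ⟨h.2.2, Ne.symm h.2.1, h.1⟩
  · rintro ⟨v, w⟩ _
    rfl

theorem bdry_add {R : Type*} [CommRing R] (c d : Finset V → R) :
    bdry (c + d) = bdry c + bdry d := by
  funext t
  simp only [bdry, Pi.add_apply, smul_add, Finset.sum_add_distrib]

theorem bdry_sub {R : Type*} [CommRing R] (c d : Finset V → R) :
    bdry (c - d) = bdry c - bdry d := by
  funext t
  simp only [bdry, Pi.sub_apply, smul_sub, Finset.sum_sub_distrib]

theorem exists_of_bdry_ne_zero {R : Type*} [CommRing R] {c : Finset V → R} {t : Finset V}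
    (h : bdry c t ≠ 0) : ∃ v, v ∉ t ∧ c (insert v t) ≠ 0 := by
  obtain ⟨v, hv, hne⟩ := Finset.exists_ne_zero_of_sum_ne_zero h
  exact ⟨v, Finset.mem_compl.1 hv, fun h0 => hne (by rw [h0, smul_zero])⟩

theorem IsChainOn.bdry {R : Type*} [CommRing R] {Δ : ASC V} {k : ℤ} {c : Finset V → R}
    (hc : IsChainOn (↑Δ.faces) k c) : IsChainOn (↑Δ.faces) (k - 1) (bdry c) := by
  intro t ht
  obtain ⟨v, hv, hne⟩ := exists_of_bdry_ne_zero ht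
  obtain ⟨hmem, hcard⟩ := hc _ hne
  refine ⟨Δ.down_closed hmem (Finset.subset_insert v t), ?_⟩
  rw [Finset.card_insert_of_notMem hv] at hcard
  push_cast at hcard
  linarith

theorem IsChainOn.mono {R : Type*} [CommRing R] {S T : Set (Finset V)} (hST : S ⊆ T) {k : ℤ}
    {c : Finset V → R} (hc : IsChainOn S k c) : IsChainOn T k c :=
  fun s hs => ⟨hST (hc s hs).1, (hc s hs).2⟩

theorem IsChainOn.add {R : Type*} [CommRing R] {S : Set (Finset V)} {k : ℤ}
    {c d : Finset V → R} (hc : IsChainOn S k c) (hd : IsChainOn S k d) :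
    IsChainOn S k (c + d) := by
  intro s hs
  by_cases h : c s = 0
  · exact hd s fun h' => hs (by rw [Pi.add_apply, h, h', add_zero])
  · exact hc s h

theorem IsChainOn.sub {R : Type*} [CommRing R] {S : Set (Finset V)} {k : ℤ}
    {c d : Finset V → R} (hc : IsChainOn S k c) (hd : IsChainOn S k d) :
    IsChainOn S k (c - d) := by
  intro s hs
  by_cases h : c s = 0
  · exact hd s fun h' => hs (by rw [Pi.sub_apply, h, h', sub_zero])
  · exact hc s h

theorem vsupp_bdry_subset {R : Type*} [CommRing R] (c : Finset V → R) :
    vsupp (bdry c) ⊆ vsupp c := by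
  rintro v ⟨t, ht, hv⟩
  obtain ⟨w, -, hne⟩ := exists_of_bdry_ne_zero ht
  exact ⟨_, hne, Finset.mem_insert_of_mem hv⟩

theorem vsupp_add_subset {R : Type*} [CommRing R] (c d : Finset V → R) :
    vsupp (c + d) ⊆ vsupp c ∪ vsupp d := by
  rintro v ⟨t, ht, hv⟩
  by_cases h : c t = 0
  · exact Or.inr ⟨t, fun h' => ht (by rw [Pi.add_apply, h, h', add_zero]), hv⟩
  · exact Or.inl ⟨t, h, hv⟩

theorem vsupp_sub_subset {R : Type*} [CommRing R] (c d : Finset V → R) :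
    vsupp (c - d) ⊆ vsupp c ∪ vsupp d := by
  rintro v ⟨t, ht, hv⟩
  by_cases h : c t = 0
  · exact Or.inr ⟨t, fun h' => ht (by rw [Pi.sub_apply, h, h', sub_zero]), hv⟩
  · exact Or.inl ⟨t, h, hv⟩

/-- If a cycle is a sum of a chain of `Δ` and a chain of `Γ`, then the boundary of the latter
is a chain of `Γ ∩ Δ`. -/
theorem IsChainOn.bdry_ainter {R : Type*} [CommRing R] {Δ Γ : ASC V} {k : ℤ}
    {x y : Finset V → R} (hx : IsChainOn (↑Δ.faces) k x) (hy : IsChainOn (↑Γ.faces) k y)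
    (h : _root_.bdry (x + y) = 0) :
    IsChainOn (↑(ainter Γ Δ).faces) (k - 1) (_root_.bdry y) := by
  intro t ht
  have hxt : _root_.bdry x t ≠ 0 := by
    intro h0
    have := congrFun h t
    rw [bdry_add, Pi.add_apply, h0, zero_add] at this
    exact ht this
  obtain ⟨hΓ, hcard⟩ := hy.bdry t ht
  exact ⟨Finset.mem_inter.2 ⟨hΓ, (hx.bdry t hxt).1⟩, hcard⟩

/-- **Dirac's Gluing Lemma, part (ii)** (Lemma 4.6(ii)): if `Δ` is resolution
`k`-chordal over `R` and the relative complex `(Γ, Γ ∩ Δ)` is resolution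
`k`-chordal over `R`, then `Δ ∪ Γ` is resolution `k`-chordal over `R`. -/
theorem dirac_gluing_ii {V : Type*} [Fintype V] [LinearOrder V]
    (R : Type*) [CommRing R] (Δ Γ : ASC V) (k : ℤ)
    (hΔ : ResChordal R Δ k) (hrel : RelResChordal R Γ (ainter Γ Δ) k) :
    ResChordal R (aunion Δ Γ) k := by
  intro z hz hbz
  let x : Finset V → R := fun s => if s ∈ Δ.faces then z s else 0
  let y : Finset V → R := fun s => if s ∈ Δ.faces then 0 else z s
  have hxy : x + y = z := by
    funext s
    by_cases h : s ∈ Δ.faces <;> simp [x, y, h]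
  have hx : IsChainOn (↑Δ.faces) k x := by
    intro s hs
    by_cases h : s ∈ Δ.faces
    · exact ⟨h, (hz s (by simpa [x, h] using hs)).2⟩
    · simp [x, h] at hs
  have hy_off : ∀ s, y s ≠ 0 → s ∉ Δ.faces ∧ z s ≠ 0 := by
    intro s hs
    by_cases h : s ∈ Δ.faces
    · simp [y, h] at hs
    · exact ⟨h, by simpa [y, h] using hs⟩
  have hy : IsChainOn (↑Γ.faces) k y := by
    intro s hs
    obtain ⟨h, hzs⟩ := hy_off s hs
    obtain ⟨hmem, hcard⟩ := hz s hzs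
    exact ⟨(Finset.mem_union.1 hmem).resolve_left h, hcard⟩
  obtain ⟨c, hc, -, hcy, hcv⟩ := hrel y hy
    (fun s hs hmem => (hy_off s hs).1 (Finset.mem_inter.1 hmem).2)
    (hx.bdry_ainter hy (by rw [hxy, hbz]))
  have hcz : vsupp c ⊆ vsupp z := by
    rw [hcv]
    rintro v ⟨s, hs, hv⟩
    exact ⟨s, (hy_off s hs).2, hv⟩
  have hsub : z - bdry c = x - (bdry c - y) := by
    rw [← hxy]
    abel
  obtain ⟨d, hd, hbd, hdv⟩ := hΔ (z - bdry c)
    (by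
      rw [hsub]
      exact hx.sub (hcy.mono fun s hs => (Finset.mem_inter.1 hs).2))
    (by rw [bdry_sub, hbz, bdry_bdry, sub_zero])
  have hbdry : bdry (c + d) = z := by
    rw [bdry_add, hbd, add_sub_cancel]
  refine ⟨c + d, ?_, hbdry, Set.Subset.antisymm ?_ ?_⟩
  · exact (hc.mono fun s hs => Finset.mem_union_right _ hs).add
      (hd.mono fun s hs => Finset.mem_union_left _ hs)
  · refine (vsupp_add_subset c d).trans (Set.union_subset hcz ?_)
    rw [hdv]
    exact (vsupp_sub_subset z (bdry c)).trans
      (Set.union_subset subset_rfl ((vsupp_bdry_subset c).trans hcz))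
  · have h := vsupp_bdry_subset (c + d)
    rwa [hbdry] at h
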